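/- Let B_b be the 3×3 Hermitian Mindlin–Reissner dispersion matrix with upper-left 2×2 block A_b given by A_b[1,1] = (ρh³/12)ω² − κhGb² − D((1−ν)/2·k_x² + k_y²), A_b[2,2] = (ρh³/12)ω² − κhGb² − D((1−ν)/2·k_y² + k_x²), A_b[1,2] = A_b[2,1] = −(D(1+ν)/2)k_x k_y, off-diagonal entries (−i b κ h G k_y, −i b κ h G k_x)ᵀ in the third column and their conjugates in the third row, and lower-right entry h(ρω² − κGk²). Then B_b = T_k C_b T_kᵀ where T_k is the orthogonal matrix with columns (0,0,1)ᵀ, (k_y/k, k_x/k, 0)ᵀ, (−k_x/k, k_y/k, 0)ᵀ, and C_b is the block-diagonal matrix with upper 2×2 block [[h(ρω² − κGk²), i b κ h k G],[−i b κ h k G, (ρh³/12)ω² − Dk² − b²hκG]] and lower 1×1 block (ρh³/12)ω² − D(1−ν)/2·k² − κb²hG, k = √(k_x²+k_y²). -/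

import Mathlib

open Matrix Complex

/-- Block diagonalization of the Mindlin–Reissner dispersion matrix:
B_b = T_k C_b T_kᵀ. -/
theorem mindlin_reissner_block_diagonalization
    (ρ h D ν κ G b ω kx ky k : ℝ)
    (hk : 0 < kx ^ 2 + ky ^ 2) (hkdef : k = Real.sqrt (kx ^ 2 + ky ^ 2)) :
    (!![(((ρ * h ^ 3 / 12) * ω ^ 2 - κ * h * G * b ^ 2
            - D * ((1 - ν) / 2 * kx ^ 2 + ky ^ 2) : ℝ) : ℂ),
        ((-(D * (1 + ν) / 2) * kx * ky : ℝ) : ℂ),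
        -Complex.I * (b * κ * h * G * ky : ℝ);
        ((-(D * (1 + ν) / 2) * kx * ky : ℝ) : ℂ),
        (((ρ * h ^ 3 / 12) * ω ^ 2 - κ * h * G * b ^ 2
            - D * ((1 - ν) / 2 * ky ^ 2 + kx ^ 2) : ℝ) : ℂ),
        -Complex.I * (b * κ * h * G * kx : ℝ);
        Complex.I * (b * κ * h * G * ky : ℝ),
        Complex.I * (b * κ * h * G * kx : ℝ),
        ((h * (ρ * ω ^ 2 - κ * G * k ^ 2) : ℝ) : ℂ)] : Matrix (Fin 3) (Fin 3) ℂ)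
    = (!![0, ((ky / k : ℝ) : ℂ), ((-(kx / k) : ℝ) : ℂ);
          0, ((kx / k : ℝ) : ℂ), ((ky / k : ℝ) : ℂ);
          1, 0, 0] : Matrix (Fin 3) (Fin 3) ℂ)
      * (!![((h * (ρ * ω ^ 2 - κ * G * k ^ 2) : ℝ) : ℂ),
            Complex.I * (b * κ * h * k * G : ℝ), 0;
            -Complex.I * (b * κ * h * k * G : ℝ),
            (((ρ * h ^ 3 / 12) * ω ^ 2 - D * k ^ 2 - b ^ 2 * h * κ * G : ℝ) : ℂ), 0;
            0, 0,
            (((ρ * h ^ 3 / 12) * ω ^ 2 - D * (1 - ν) / 2 * k ^ 2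
                - κ * b ^ 2 * h * G : ℝ) : ℂ)] : Matrix (Fin 3) (Fin 3) ℂ)
      * (!![0, ((ky / k : ℝ) : ℂ), ((-(kx / k) : ℝ) : ℂ);
            0, ((kx / k : ℝ) : ℂ), ((ky / k : ℝ) : ℂ);
            1, 0, 0] : Matrix (Fin 3) (Fin 3) ℂ)ᵀ := by
  have hk0 : k ≠ 0 := by
    rw [hkdef]; exact (Real.sqrt_pos.mpr hk).ne'
  have hk2 : k ^ 2 = kx ^ 2 + ky ^ 2 := by
    rw [hkdef]; exact Real.sq_sqrt hk.le
  obtain ⟨c, hc⟩ : ∃ c, c = kx / k := ⟨_, rfl⟩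
  obtain ⟨s, hs⟩ : ∃ s, s = ky / k := ⟨_, rfl⟩
  have hcs : c ^ 2 + s ^ 2 = 1 := by
    rw [hc, hs]; field_simp; exact hk2.symm
  have hx : kx = c * k := by rw [hc]; field_simp
  have hy : ky = s * k := by rw [hs]; field_simp
  rw [← hc, ← hs]
  clear hc hs hk2 hkdef hk
  subst hx hy
  have hC : (c : ℂ) ^ 2 + (s : ℂ) ^ 2 = 1 := by exact_mod_cast hcs
  ext i j
  fin_cases i <;> fin_cases j <;>
    simp [Matrix.mul_apply, Fin.sum_univ_three] <;>
    first
    | ring1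
    | linear_combination
        (-((ρ : ℂ) * h ^ 3 / 12 * ω ^ 2 - κ * h * G * b ^ 2)) * hC
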